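/- arXiv:1605.09145 — 2 statements merged into one kernel-verified Lean document; each statement's English description precedes it below -/
import Mathlib

section
/- Let k be a field of characteristic different from 2, let S = k[x, y, t₁, t₂], and let I = (xy, xt₁, xt₂ − y² − t₁², yt₁, yt₂, t₁t₂, t₂²). Then every nonzero linear form ℓ ∈ S₁ with ℓ² ∈ I is a scalar multiple of t₂; that is, S/I has exactly one null-square linear form up to scalar. -/
open MvPolynomial

theorem coeff_mul_X_mul_X {σ R : Type*} [DecidableEq σ] [CommSemiring R]
    (p : MvPolynomial σ R) (i j u v : σ) :
    coeff (Finsupp.single i 1 + Finsupp.single j 1) (p * (X u * X v)) =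
      if s(u, v) = s(i, j) then coeff 0 p else 0 := by
  have hX : (X u * X v : MvPolynomial σ R) =
      monomial (Finsupp.single u 1 + Finsupp.single v 1) 1 := by
    simp [X, monomial_mul]
  rw [hX, coeff_mul_monomial']
  by_cases h : s(u, v) = s(i, j)
  · have he : (Finsupp.single u 1 + Finsupp.single v 1 : σ →₀ ℕ) =
        Finsupp.single i 1 + Finsupp.single j 1 := by
      rcases Sym2.eq_iff.mp h with ⟨rfl, rfl⟩ | ⟨rfl, rfl⟩
      · rfl
      · exact add_comm _ _
    simp [h, he]
  · rw [if_neg h, if_neg]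
    intro hle
    apply h
    have hu := hle u
    have hv := hle v
    simp only [Finsupp.add_apply, Finsupp.single_apply] at hu hv
    rw [Sym2.eq_iff]
    grind

theorem stmt13 (k : Type*) [Field k] (hchar : ringChar k ≠ 2) :
    letI x : MvPolynomial (Fin 4) k := X 0
    letI y : MvPolynomial (Fin 4) k := X 1
    letI t₁ : MvPolynomial (Fin 4) k := X 2
    letI t₂ : MvPolynomial (Fin 4) k := X 3
    letI I : Ideal (MvPolynomial (Fin 4) k) :=
      Ideal.span {x * y, x * t₁, x * t₂ - y ^ 2 - t₁ ^ 2,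
        y * t₁, y * t₂, t₁ * t₂, t₂ ^ 2}
    ∀ ℓ : MvPolynomial (Fin 4) k, ℓ.IsHomogeneous 1 → ℓ ≠ 0 → ℓ ^ 2 ∈ I →
      ∃ a : k, ℓ = C a * t₂ := by
  intro ℓ hℓ _ hI
  rw [← mem_homogeneousSubmodule, homogeneousSubmodule_one_eq_span_X,
    Submodule.mem_span_range_iff_exists_fun] at hℓ
  obtain ⟨c, rfl⟩ := hℓ
  simp only [Ideal.mem_span_insert, Ideal.mem_span_singleton'] at hI
  obtain ⟨p₁, _, ⟨p₂, _, ⟨p₃, _, ⟨p₄, _, ⟨p₅, _, ⟨p₆, _, ⟨p₇, rfl⟩, rfl⟩, rfl⟩, rfl⟩, rfl⟩,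
    rfl⟩, h⟩ := hI
  have hcoeff (i j : Fin 4) := congrArg (coeff (Finsupp.single i 1 + Finsupp.single j 1)) h
  simp only [Fin.sum_univ_four, smul_eq_C_mul, pow_two, mul_add, add_mul, mul_sub,
    mul_mul_mul_comm (C _) (X _), coeff_add, coeff_sub, coeff_mul_X_mul_X] at hcoeff
  have hxx := hcoeff 0 0
  have hyy := hcoeff 1 1
  have htt := hcoeff 2 2
  have hxt := hcoeff 0 3
  simp [- map_mul, ← C_mul] at hxx hyy htt hxt
  have h₁ : c 1 = 0 := by
    apply pow_eq_zero_iff two_ne_zero |>.mp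
    grind
  have h₂ : c 2 = 0 := by
    apply pow_eq_zero_iff two_ne_zero |>.mp
    grind
  exact ⟨c 3, by simp [Fin.sum_univ_four, hxx, h₁, h₂, smul_eq_C_mul]⟩
end

section
/- Let k be a field, let S = k[x, y, t₁, t₂], and let J = (xy − t₁², xt₁, xt₂ − y², yt₁, yt₂, t₁t₂, t₂²). Then the colon ideals satisfy J : (x + t₁) = J + (y − t₁) and J : (y − t₁) = J + (x + t₁, t₂). Equivalently, in R = S/J the annihilator of the image of x + t₁ is the ideal generated by the image of y − t₁, and the annihilator of the image of y − t₁ is the ideal generated by the images of x + t₁ and t₂. -/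
open MvPolynomial

/-- The relations of the ideal `J`, imposed on four elements of a commutative ring. -/
structure QuadricRelations {A : Type*} [CommRing A] (x y t u : A) : Prop where
  xy : x * y = t ^ 2
  xt : x * t = 0
  xu : x * u = y ^ 2
  yt : y * t = 0
  yu : y * u = 0
  tu : t * u = 0
  uu : u ^ 2 = 0

section NormalForm

variable {k A : Type*} [Field k] [CommRing A] [Algebra k A] {x y t u : A}

theorem exists_polynomial_eq_linear_add (P : Polynomial k) :
    ∃ (a p : k) (Q : Polynomial k), P = .C a + .X * (.C p + .X * Q) := by
  refine ⟨P.coeff 0, P.divX.coeff 0, P.divX.divX, ?_⟩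
  have h₁ := P.divX_mul_X_add
  have h₂ := P.divX.divX_mul_X_add
  linear_combination -h₁ - Polynomial.X * h₂

theorem QuadricRelations.exists_normal_form (h : QuadricRelations x y t u)
    (f : MvPolynomial (Fin 4) k) :
    ∃ (P : Polynomial k) (b c d e g : k),
      aeval ![x, y, t, u] f = Polynomial.aeval x P + algebraMap k A b * y +
        algebraMap k A c * t + algebraMap k A d * u + algebraMap k A e * (x * y) +
        algebraMap k A g * y ^ 2 := by
  obtain ⟨xy, xt, xu, yt, yu, tu, uu⟩ := h
  induction f using MvPolynomial.induction_on with
  | C a => exact ⟨.C a, 0, 0, 0, 0, 0, by simp⟩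
  | add p q hp hq =>
    obtain ⟨P, b, c, d, e, g, hp⟩ := hp
    obtain ⟨P', b', c', d', e', g', hq⟩ := hq
    refine ⟨P + P', b + b', c + c', d + d', e + e', g + g', ?_⟩
    simp only [map_add, hp, hq]
    ring
  | mul_X p i hp =>
    obtain ⟨P, b, c, d, e, g, hp⟩ := hp
    obtain ⟨a, p', Q, rfl⟩ := exists_polynomial_eq_linear_add P
    simp only [map_mul, hp, aeval_X]
    set B := algebraMap k A b
    set C' := algebraMap k A c
    set D := algebraMap k A d
    set E := algebraMap k A e
    set G := algebraMap k A g
    have hxxy : x * (x * y) = 0 := by linear_combination x * xy + t * xt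
    have hxyy : x * y ^ 2 = 0 := by linear_combination y * xy + t * yt
    have hyyy : y ^ 3 = 0 := by linear_combination -y * xu + x * yu
    fin_cases i
    · refine ⟨.X * (.C a + .X * (.C p' + .X * Q)), 0, 0, 0, b, d, ?_⟩
      simp [B, C', D, E, G]
      linear_combination C' * xt + D * xu + E * hxxy + G * hxyy
    · refine ⟨0, a, 0, 0, p', b, ?_⟩
      simp [B, C', D, E, G]
      linear_combination Polynomial.aeval x Q * hxxy + C' * yt + D * yu + E * hxyy + G * hyyy
    · refine ⟨0, 0, a, 0, c, 0, ?_⟩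
      simp [B, C', D, E, G]
      linear_combination (algebraMap k A p' + x * Polynomial.aeval x Q) * xt + B * yt -
        C' * xy + D * tu + E * x * yt + G * y * yt
    · refine ⟨0, 0, 0, a, 0, p', ?_⟩
      simp [B, C', D, E, G]
      linear_combination algebraMap k A p' * xu +
        Polynomial.aeval x Q * (x * xu + hxyy) + B * yu + C' * tu + D * uu +
        E * x * yu + G * y * yu

end NormalForm

section Quadrics

variable (k : Type*) [Field k]

/-- The ideal `(xy - t₁², xt₁, xt₂ - y², yt₁, yt₂, t₁t₂, t₂²)`. -/
noncomputable abbrev quadricIdeal : Ideal (MvPolynomial (Fin 4) k) :=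
  Ideal.span {X 0 * X 1 - X 2 ^ 2, X 0 * X 2, X 0 * X 3 - X 1 ^ 2,
    X 1 * X 2, X 1 * X 3, X 2 * X 3, X 3 ^ 2}

variable {k}

theorem quadricRelations_mk :
    QuadricRelations (Ideal.Quotient.mk (quadricIdeal k) (X 0))
      (Ideal.Quotient.mk (quadricIdeal k) (X 1)) (Ideal.Quotient.mk (quadricIdeal k) (X 2))
      (Ideal.Quotient.mk (quadricIdeal k) (X 3)) := by
  constructor <;> simp only [← map_mul, ← map_pow]
  case xy | xu => exact Ideal.Quotient.eq.2 (Ideal.subset_span (by simp))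
  all_goals exact Ideal.Quotient.eq_zero_iff_mem.2 (Ideal.subset_span (by simp))

theorem exists_normal_form_mk (f : MvPolynomial (Fin 4) k) :
    ∃ (P : Polynomial k) (b c d e g : k),
      f - (Polynomial.aeval (X 0) P + C b * X 1 + C c * X 2 + C d * X 3 +
        C e * (X 0 * X 1) + C g * X 1 ^ 2) ∈ quadricIdeal k := by
  obtain ⟨P, b, c, d, e, g, h⟩ := (quadricRelations_mk (k := k)).exists_normal_form f
  refine ⟨P, b, c, d, e, g, Ideal.Quotient.eq.1 ?_⟩
  have hf : aeval ![Ideal.Quotient.mk (quadricIdeal k) (X 0),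
      Ideal.Quotient.mk (quadricIdeal k) (X 1), Ideal.Quotient.mk (quadricIdeal k) (X 2),
      Ideal.Quotient.mk (quadricIdeal k) (X 3)] f = Ideal.Quotient.mk (quadricIdeal k) f := by
    have : aeval ![Ideal.Quotient.mk (quadricIdeal k) (X 0),
      Ideal.Quotient.mk (quadricIdeal k) (X 1), Ideal.Quotient.mk (quadricIdeal k) (X 2),
      Ideal.Quotient.mk (quadricIdeal k) (X 3)] = Ideal.Quotient.mkₐ k (quadricIdeal k) := by
      ext i
      fin_cases i <;> simp
    rw [this]
    rfl
  have hP : Ideal.Quotient.mk (quadricIdeal k) (Polynomial.aeval (X 0) P) =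
      Polynomial.aeval (Ideal.Quotient.mk (quadricIdeal k) (X 0)) P :=
    (Polynomial.aeval_algHom_apply (Ideal.Quotient.mkₐ k (quadricIdeal k)) (X 0) P).symm
  rw [← hf, h]
  simp only [map_add, map_mul, map_pow, hP]
  rfl

theorem aeval_eq_zero_of_mem_quadricIdeal {f : MvPolynomial (Fin 4) k}
    (hf : f ∈ quadricIdeal k) :
    aeval ![(Polynomial.X : Polynomial k), 0, 0, 0] f = 0 := by
  have : quadricIdeal k ≤ RingHom.ker (aeval ![(Polynomial.X : Polynomial k), 0, 0, 0]) := by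
    rw [Ideal.span_le]
    rintro g (rfl | rfl | rfl | rfl | rfl | rfl | rfl) <;> simp [RingHom.mem_ker]
  exact this hf

theorem coeff_mul_X_mul_X_s17 (a : MvPolynomial (Fin 4) k) (i j l m : Fin 4) :
    coeff (Finsupp.single l 1 + Finsupp.single m 1) (a * (X i * X j)) =
      if i = l ∧ j = m ∨ i = m ∧ j = l then coeff 0 a else 0 := by
  rw [← mul_assoc, coeff_mul_X']
  by_cases h₁ : j = m
  · subst h₁
    by_cases h : i = l
    · subst h; simp [coeff_mul_X']
    · by_cases h' : j = l
      · subst h'; simp [coeff_mul_X', h]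
      · simp [coeff_mul_X', h, h']
  · by_cases h₂ : j = l
    · subst h₂
      by_cases h : i = m
      · subst h; simp [coeff_mul_X']
      · simp [coeff_mul_X', h, h₁]
    · simp [h₁, h₂]

theorem coeff_eq_zero_of_mem_quadricIdeal {f : MvPolynomial (Fin 4) k}
    (hf : f ∈ quadricIdeal k) :
    coeff (Finsupp.single 0 1 + Finsupp.single 1 1) f +
      coeff (Finsupp.single 2 1 + Finsupp.single 2 1) f = 0 ∧
    coeff (Finsupp.single 0 1 + Finsupp.single 3 1) f +
      coeff (Finsupp.single 1 1 + Finsupp.single 1 1) f = 0 := by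
  simp only [quadricIdeal, Ideal.mem_span_insert, Ideal.mem_span_singleton'] at hf
  obtain ⟨a₁, _, ⟨a₂, _, ⟨a₃, _, ⟨a₄, _, ⟨a₅, _, ⟨a₆, _, ⟨a₇, rfl⟩, rfl⟩, rfl⟩, rfl⟩, rfl⟩,
    rfl⟩, rfl⟩ := hf
  simp [pow_two, mul_sub, coeff_mul_X_mul_X_s17]

theorem eq_zero_of_mem_quadricIdeal {α β : k}
    (h : C α * (X 0 * X 1) + C β * X 1 ^ 2 ∈ quadricIdeal k) : α = 0 ∧ β = 0 := by
  have h' := coeff_eq_zero_of_mem_quadricIdeal h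
  rw [pow_two] at h'
  simpa only [coeff_add, coeff_mul_X_mul_X_s17, coeff_zero_C, Fin.reduceEq, and_self, and_false,
    and_true, or_self, or_false, if_true, if_false, add_zero, zero_add] using h'

theorem mul_X_add_X_mem_quadricIdeal_iff (f : MvPolynomial (Fin 4) k) :
    f * (X 0 + X 2) ∈ quadricIdeal k ↔ f ∈ quadricIdeal k ⊔ Ideal.span {X 1 - X 2} := by
  obtain ⟨xy, xt, xu, yt, yu, tu, uu⟩ := quadricRelations_mk (k := k)
  constructor
  · intro hf
    obtain ⟨P, b, c, d, e, g, h⟩ := exists_normal_form_mk f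
    obtain rfl : P = 0 := by
      have h₁ := aeval_eq_zero_of_mem_quadricIdeal hf
      have h₂ := aeval_eq_zero_of_mem_quadricIdeal h
      simp only [map_mul, map_add, map_sub, map_pow, aeval_X, aeval_C,
        ← Polynomial.aeval_algHom_apply] at h₁ h₂
      simp at h₁ h₂
      simpa [h₁] using h₂
    have hz : C (b + c) * (X 0 * X 1) + C d * X 1 ^ 2 ∈ quadricIdeal k := by
      rw [← Ideal.Quotient.eq_zero_iff_mem] at hf h ⊢
      simp only [map_add, map_sub, map_mul, map_pow, map_zero] at hf h xy ⊢
      set x := Ideal.Quotient.mk (quadricIdeal k) (X 0)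
      set y := Ideal.Quotient.mk (quadricIdeal k) (X 1)
      set t := Ideal.Quotient.mk (quadricIdeal k) (X 2)
      set u := Ideal.Quotient.mk (quadricIdeal k) (X 3)
      set B := Ideal.Quotient.mk (quadricIdeal k) (C b)
      set C' := Ideal.Quotient.mk (quadricIdeal k) (C c)
      set D := Ideal.Quotient.mk (quadricIdeal k) (C d)
      set E := Ideal.Quotient.mk (quadricIdeal k) (C e)
      set G := Ideal.Quotient.mk (quadricIdeal k) (C g)
      linear_combination hf - (x + t) * h - B * yt - C' * (xt - xy) - D * (xu + tu) -
        E * (x * xy + t * xt + x * yt) - G * (y * xy + t * yt + y * yt)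
    obtain ⟨hbc, rfl⟩ := eq_zero_of_mem_quadricIdeal hz
    obtain rfl : c = -b := by linear_combination hbc
    refine Submodule.mem_sup.2 ⟨f - (C b + C e * X 0 + C g * X 1) * (X 1 - X 2), ?_,
      (C b + C e * X 0 + C g * X 1) * (X 1 - X 2),
      Ideal.mul_mem_left _ _ (Ideal.subset_span rfl), by ring⟩
    rw [← Ideal.Quotient.eq_zero_iff_mem] at h ⊢
    simp only [map_add, map_sub, map_mul, map_pow, map_zero, map_neg] at h ⊢
    linear_combination h + Ideal.Quotient.mk (quadricIdeal k) (C e) * xt +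
      Ideal.Quotient.mk (quadricIdeal k) (C g) * yt
  · intro hf
    obtain ⟨j, hj, w, hw, rfl⟩ := Submodule.mem_sup.1 hf
    obtain ⟨a, rfl⟩ := Ideal.mem_span_singleton'.1 hw
    rw [← Ideal.Quotient.eq_zero_iff_mem] at hj ⊢
    simp only [map_add, map_sub, map_mul] at hj ⊢
    rw [hj]
    linear_combination Ideal.Quotient.mk (quadricIdeal k) a * (xy - xt + yt)

theorem mul_X_sub_X_mem_quadricIdeal_iff (f : MvPolynomial (Fin 4) k) :
    f * (X 1 - X 2) ∈ quadricIdeal k ↔ f ∈ quadricIdeal k ⊔ Ideal.span {X 0 + X 2, X 3} := by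
  obtain ⟨xy, xt, xu, yt, yu, tu, uu⟩ := quadricRelations_mk (k := k)
  constructor
  · intro hf
    obtain ⟨P, b, c, d, e, g, h⟩ := exists_normal_form_mk f
    obtain ⟨a, p, Q, rfl⟩ := exists_polynomial_eq_linear_add P
    simp only [map_add, map_mul, Polynomial.aeval_X, Polynomial.aeval_C, algebraMap_eq] at h
    generalize Polynomial.aeval (X 0 : MvPolynomial (Fin 4) k) Q = q at h
    rw [← Ideal.Quotient.eq_zero_iff_mem] at h hf
    simp only [map_add, map_sub, map_mul, map_pow] at hf h
    set x := Ideal.Quotient.mk (quadricIdeal k) (X 0) with hx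
    set y := Ideal.Quotient.mk (quadricIdeal k) (X 1) with hy
    set t := Ideal.Quotient.mk (quadricIdeal k) (X 2)
    set u := Ideal.Quotient.mk (quadricIdeal k) (X 3)
    set F := Ideal.Quotient.mk (quadricIdeal k) f
    set q' := Ideal.Quotient.mk (quadricIdeal k) q
    set A := Ideal.Quotient.mk (quadricIdeal k) (C a) with hA
    set p' := Ideal.Quotient.mk (quadricIdeal k) (C p) with hp
    set B := Ideal.Quotient.mk (quadricIdeal k) (C b) with hB
    set C' := Ideal.Quotient.mk (quadricIdeal k) (C c) with hC
    set D := Ideal.Quotient.mk (quadricIdeal k) (C d)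
    set E := Ideal.Quotient.mk (quadricIdeal k) (C e)
    set G := Ideal.Quotient.mk (quadricIdeal k) (C g)
    have hxxy : x * (x * y) = 0 := by linear_combination x * xy + t * xt
    have hxyy : x * y ^ 2 = 0 := by linear_combination y * xy + t * yt
    have hyyy : y ^ 3 = 0 := by linear_combination -y * xu + x * yu
    have hred : A * (y - t) + (p' - C') * (x * y) + B * y ^ 2 = 0 := by
      linear_combination hf - (y - t) * h - q' * (hxxy - x * xt) + p' * xt + B * yt -
        C' * (yt + xy) - D * (yu - tu) - E * (hxyy - x * yt) - G * (hyyy - y * yt)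
    obtain rfl : a = 0 := by
      refine (eq_zero_of_mem_quadricIdeal (α := 0) ?_).2
      rw [← Ideal.Quotient.eq_zero_iff_mem]
      simp only [map_mul, map_pow, map_zero, zero_mul, zero_add, ← hy, ← hA]
      linear_combination y * hred + A * yt - (p' - C') * hxyy - B * hyyy
    obtain ⟨hpc, rfl⟩ : p - c = 0 ∧ b = 0 := by
      refine eq_zero_of_mem_quadricIdeal ?_
      rw [← Ideal.Quotient.eq_zero_iff_mem]
      simp only [map_add, map_sub, map_mul, map_pow, ← hx, ← hy, ← hp, ← hC, ← hB]
      simpa [hA] using hred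
    obtain rfl : p = c := sub_eq_zero.1 hpc
    refine Submodule.mem_sup.2 ⟨f - ((C p + X 0 * q + C e * X 1) * (X 0 + X 2) +
      (C d + C g * X 0) * X 3), ?_, _, Ideal.mem_span_pair.2 ⟨_, _, rfl⟩, sub_add_cancel _ _⟩
    rw [← Ideal.Quotient.eq_zero_iff_mem]
    simp only [map_add, map_sub, map_mul]
    simp only [hA, hB, map_zero] at h
    linear_combination h - q' * xt - E * yt - G * xu
  · intro hf
    obtain ⟨j, hj, w, hw, rfl⟩ := Submodule.mem_sup.1 hf
    obtain ⟨a, b, rfl⟩ := Ideal.mem_span_pair.1 hw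
    rw [← Ideal.Quotient.eq_zero_iff_mem] at hj ⊢
    simp only [map_add, map_sub, map_mul] at hj ⊢
    rw [hj]
    linear_combination Ideal.Quotient.mk (quadricIdeal k) a * (xy - xt + yt) +
      Ideal.Quotient.mk (quadricIdeal k) b * (yu - tu)

end Quadrics

theorem stmt17 (k : Type*) [Field k] :
    letI x : MvPolynomial (Fin 4) k := X 0
    letI y : MvPolynomial (Fin 4) k := X 1
    letI t₁ : MvPolynomial (Fin 4) k := X 2
    letI t₂ : MvPolynomial (Fin 4) k := X 3
    letI J : Ideal (MvPolynomial (Fin 4) k) :=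
      Ideal.span {x * y - t₁ ^ 2, x * t₁, x * t₂ - y ^ 2,
        y * t₁, y * t₂, t₁ * t₂, t₂ ^ 2}
    (∀ f : MvPolynomial (Fin 4) k,
      f * (x + t₁) ∈ J ↔ f ∈ J ⊔ Ideal.span {y - t₁}) ∧
    (∀ f : MvPolynomial (Fin 4) k,
      f * (y - t₁) ∈ J ↔ f ∈ J ⊔ Ideal.span {x + t₁, t₂}) := by
  exact ⟨mul_X_add_X_mem_quadricIdeal_iff, mul_X_sub_X_mem_quadricIdeal_iff⟩
end
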